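/- The suspension S(ℝP²) of the real projective plane is homeomorphic to S³/τ, where S³ is viewed as the suspension of S² and τ is the suspension of the antipodal map of S², i.e., τ[x, t] = [−x, t] on the suspension coordinates, and S(ℝP²) has exactly two points (the suspension points) that have no neighborhood homeomorphic to ℝ³. -/

import Mathlib

open Set

/-- The unit `2`-sphere in `ℝ³`. -/
def Sph : Set (EuclideanSpace ℝ (Fin 3)) := Metric.sphere 0 1

/-- The relation on `Y × [−1,1]` collapsing `Y × {−1}` and `Y × {1}` to points; its
quotient is the suspension `S(Y)`. -/
def suspRel (Y : Type*) (a b : Y × (Icc (-1:ℝ) 1)) : Prop :=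
  ((a.2 : ℝ) = -1 ∧ (b.2 : ℝ) = -1) ∨ ((a.2 : ℝ) = 1 ∧ (b.2 : ℝ) = 1)

/-- The suspension `S(Y)` of a space `Y`. -/
def Susp (Y : Type*) : Type _ := Quot (suspRel Y)

instance (Y : Type*) [TopologicalSpace Y] : TopologicalSpace (Susp Y) := by
  unfold Susp; infer_instance

/-- The real projective plane `ℝP² = S²/±`. -/
def RP2 : Type := Quot (fun a b : Sph => (b : EuclideanSpace ℝ (Fin 3)) = -(a : EuclideanSpace ℝ (Fin 3)))

noncomputable instance : TopologicalSpace RP2 := by unfold RP2; infer_instance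

/-- The orbit relation of `τ = S(a)`, the suspension of the antipodal map of `S²`, on
`S(S²) ≅ S³`: `[x, t] ∼ [−x, t]`. -/
def tauRel (u v : Susp Sph) : Prop :=
  ∃ (x : Sph) (t : Icc (-1:ℝ) 1) (hx : -(x : EuclideanSpace ℝ (Fin 3)) ∈ Sph),
    u = Quot.mk _ (x, t) ∧ v = Quot.mk _ ((⟨-(x : EuclideanSpace ℝ (Fin 3)), hx⟩ : Sph), t)

/-- A point `z` of a space `Z` is a manifold point (for dimension `3`) if it has an
open neighborhood homeomorphic to `ℝ³`. -/
def IsManifoldPoint {Z : Type*} [TopologicalSpace Z] (z : Z) : Prop :=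
  ∃ U : Set Z, IsOpen U ∧ z ∈ U ∧ Nonempty (U ≃ₜ EuclideanSpace ℝ (Fin 3))

namespace SuspAux

open Topology

/-- Euclidean three-space. -/
abbrev E3 := EuclideanSpace ℝ (Fin 3)

/-- The interval `[-1,1]`. -/
abbrev I1 := Icc (-1:ℝ) 1

lemma norm_sph (x : Sph) : ‖(x : E3)‖ = 1 := by
  have := x.2
  simpa [Sph] using this

lemma mem_sph {v : E3} : v ∈ Sph ↔ ‖v‖ = 1 := by simp [Sph]

/-- The antipodal map. -/
def anti (x : Sph) : Sph := ⟨-(x : E3), by rw [mem_sph, norm_neg]; exact norm_sph x⟩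

lemma anti_anti (x : Sph) : anti (anti x) = x := by
  apply Subtype.ext; simp [anti]

lemma anti_ne (x : Sph) : anti x ≠ x := by
  intro h
  have h1 : -(x : E3) = x := congrArg Subtype.val h
  have h2 : (x : E3) = 0 := by
    have : (2:ℝ) • (x : E3) = 0 := by
      rw [two_smul]; nth_rewrite 1 [← h1]; simp
    simpa using this
  have := norm_sph x
  rw [h2] at this
  simp at this

lemma continuous_anti : Continuous anti := by
  unfold anti; fun_prop

/-- The projection to `ℝP²`. -/
def q (x : Sph) : RP2 := Quot.mk _ x

lemma q_anti (x : Sph) : q (anti x) = q x := by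
  symm
  exact Quot.sound rfl

lemma q_eq_iff {x y : Sph} : q x = q y ↔ y = x ∨ y = anti x := by
  constructor
  · intro h
    have h2 := Quot.eqvGen_exact h
    clear h
    induction h2 with
    | rel a b h => exact Or.inr (Subtype.ext h)
    | refl a => exact Or.inl rfl
    | symm a b _ ih =>
      rcases ih with rfl | rfl
      · exact Or.inl rfl
      · right; rw [anti_anti]
    | trans a b c _ _ ih1 ih2 =>
      rcases ih1 with rfl | rfl <;> rcases ih2 with rfl | rfl
      · exact Or.inl rfl
      · exact Or.inr rfl
      · exact Or.inr rfl
      · left; rw [anti_anti]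
  · rintro (rfl | rfl)
    · rfl
    · rw [q_anti]

lemma isQuotientMap_q : IsQuotientMap q := isQuotientMap_quot_mk

noncomputable instance actS : MulAction ℤˣ Sph where
  smul u x := ⟨((u : ℤ) : ℝ) • (x : E3), by
    rw [mem_sph, norm_smul, norm_sph]
    rcases Int.units_eq_one_or u with rfl | rfl <;> simp⟩
  one_smul x := Subtype.ext (by
    change (((1 : ℤˣ) : ℤ) : ℝ) • (x : E3) = x
    simp)
  mul_smul u v x := Subtype.ext (by
    change (((u * v : ℤˣ) : ℤ) : ℝ) • (x : E3) = ((u : ℤ) : ℝ) • (((v : ℤ) : ℝ) • (x : E3))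
    rw [smul_smul]; push_cast; rfl)

lemma neg_one_smul_sph (x : Sph) : (-1 : ℤˣ) • x = anti x := Subtype.ext (by
  change (((-1 : ℤˣ) : ℤ) : ℝ) • (x : E3) = -x
  simp)

lemma isQuotientCoveringMap_q : IsQuotientCoveringMap q ℤˣ where
  __ := isQuotientMap_q
  continuous_const_smul u := by
    rcases Int.units_eq_one_or u with rfl | rfl
    · simp only [one_smul]; exact continuous_id
    · simp only [neg_one_smul_sph]; exact continuous_anti
  apply_eq_iff_mem_orbit {a b} := by
    rw [eq_comm, q_eq_iff, MulAction.mem_orbit_iff]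
    constructor
    · rintro (rfl | rfl)
      · exact ⟨1, one_smul _ _⟩
      · exact ⟨-1, neg_one_smul_sph _⟩
    · rintro ⟨u, rfl⟩
      rcases Int.units_eq_one_or u with rfl | rfl
      · left; exact one_smul _ _
      · right; exact neg_one_smul_sph _
  disjoint e := by
    refine ⟨{y | 0 < inner ℝ (e : E3) (y : E3)}, ?_, ?_⟩
    · apply IsOpen.mem_nhds
      · exact isOpen_lt continuous_const (by fun_prop)
      · simp [norm_sph]
    · rintro u ⟨_, ⟨y, hy, rfl⟩, hz⟩
      rcases Int.units_eq_one_or u with rfl | rfl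
      · rfl
      · exfalso
        simp only [neg_one_smul_sph, mem_ofPred_eq, anti, inner_neg_right] at hy hz
        linarith

lemma isCoveringMap_q : IsCoveringMap q := isQuotientCoveringMap_q.isCoveringMap

lemma isOpenQuotientMap_q : IsOpenQuotientMap q := isQuotientCoveringMap_q.isOpenQuotientMap

/-- The projection `S² × [-1,1] → S(ℝP²)`. -/
def Q (a : Sph × I1) : Susp RP2 := Quot.mk _ (q a.1, a.2)

lemma isQuotientMap_Q : IsQuotientMap Q :=
  (isQuotientMap_quot_mk (r := suspRel RP2)).comp
    (isOpenQuotientMap_q.prodMap IsOpenQuotientMap.id).isQuotientMap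

/-- The projection `S² × [-1,1] → S³/τ`. -/
def P (a : Sph × I1) : Quot tauRel := Quot.mk _ (Quot.mk _ a)

lemma isQuotientMap_P : IsQuotientMap P :=
  (isQuotientMap_quot_mk (r := tauRel)).comp (isQuotientMap_quot_mk (r := suspRel Sph))

lemma tauRel_mk (x : Sph) (t : I1) :
    tauRel (Quot.mk _ (x, t)) (Quot.mk _ (anti x, t)) :=
  ⟨x, t, (anti x).2, rfl, rfl⟩

/-- Forward map. -/
def fwd : Susp RP2 → Quot tauRel :=
  Quot.lift (fun a : RP2 × I1 => Quot.lift (fun x : Sph => P (x, a.2))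
      (fun x y h => by
        have : y = anti x := Subtype.ext h
        subst this
        exact Quot.sound (tauRel_mk x a.2)) a.1)
    (by
      rintro ⟨a, s⟩ ⟨b, t⟩ h
      induction a using Quot.ind with | mk a => ?_
      induction b using Quot.ind with | mk b => ?_
      exact congrArg (Quot.mk tauRel) (Quot.sound h))

lemma fwd_Q (a : Sph × I1) : fwd (Q a) = P a := rfl

/-- The map `S(S²) → S(ℝP²)`. -/
def bwd0 : Susp Sph → Susp RP2 := Quot.lift Q (by
  rintro ⟨a, s⟩ ⟨b, t⟩ h
  exact Quot.sound h)

/-- Backward map. -/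
def bwd : Quot tauRel → Susp RP2 :=
  Quot.lift bwd0 (by
    rintro _ _ ⟨x, t, hx, rfl, rfl⟩
    change Q (x, t) = Q (anti x, t)
    unfold Q
    simp only [q_anti]
    rfl)

lemma bwd_P (a : Sph × I1) : bwd (P a) = Q a := rfl

lemma part1 : Nonempty (Susp RP2 ≃ₜ Quot tauRel) :=
  ⟨{ toFun := fwd
     invFun := bwd
     left_inv := fun z => by
       obtain ⟨a, rfl⟩ := isQuotientMap_Q.surjective z
       rfl
     right_inv := fun z => by
       obtain ⟨a, rfl⟩ := isQuotientMap_P.surjective z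
       rfl
     continuous_toFun := isQuotientMap_Q.continuous_iff.2 isQuotientMap_P.continuous
     continuous_invFun := isQuotientMap_P.continuous_iff.2 isQuotientMap_Q.continuous }⟩

/-! ### Lifting maps from punctured space -/

lemma pm_const {X : Type*} [TopologicalSpace X] {W : Set X} (hW : IsPreconnected W) {u : X → ℝ}
    (hu : ContinuousOn u W) (h1 : ∀ v ∈ W, u v = 1 ∨ u v = -1) :
    (∀ v ∈ W, u v = 1) ∨ (∀ v ∈ W, u v = -1) := by
  by_contra! h
  obtain ⟨⟨a, ha, ha'⟩, ⟨b, hb, hb'⟩⟩ := h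
  have ha := (h1 a ha).resolve_left ha'
  have hb := (h1 b hb).resolve_right hb'
  have := hW.intermediate_value ‹a ∈ W› ‹b ∈ W› hu
  have h0 : (0:ℝ) ∈ Icc (u a) (u b) := by rw [ha, hb]; constructor <;> norm_num
  obtain ⟨c, hc, hc0⟩ := this h0
  rcases h1 c hc with h | h <;> rw [hc0] at h <;> norm_num at h

lemma lift_star {A : Set E3} (hA : IsOpen A) {c : E3} (hc : StarConvex ℝ c A) (hcA : c ∈ A)
    {f : E3 → RP2} (hf : ContinuousOn f A) :
    ∃ F : E3 → Sph, ContinuousOn F A ∧ ∀ v ∈ A, q (F v) = f v := by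
  classical
  have : ContractibleSpace A := hc.contractibleSpace ⟨c, hcA⟩
  have : LocallyPathConnectedSpace A := hA.locallyPathConnectedSpace
  obtain ⟨e₀, he₀⟩ := isQuotientMap_q.surjective (f c)
  obtain ⟨F, ⟨-, hF⟩, -⟩ := isCoveringMap_q.existsUnique_continuousMap_lifts
    (A := A) ⟨A.domRestrict f, hf.domRestrict⟩ ⟨c, hcA⟩ e₀ he₀
  refine ⟨fun v => if h : v ∈ A then F ⟨v, h⟩ else e₀, ?_, ?_⟩
  · rw [continuousOn_iff_continuous_domRestrict]
    convert F.continuous using 1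
    ext v
    simp
  · intro v hv
    simp only [hv, dite_true]
    exact congrFun hF ⟨v, hv⟩

/-- complement of the ray through `e` -/
def slit (e : E3) : Set E3 := {v | inner ℝ e v ≠ ‖v‖}

lemma isOpen_slit (e : E3) : IsOpen (slit e) :=
  isOpen_ne_fun (by fun_prop) (by fun_prop)

lemma mem_slit_iff {e : E3} (he : ‖e‖ = 1) {v : E3} :
    v ∈ slit e ↔ ¬ ∃ s : ℝ, 0 ≤ s ∧ v = s • e := by
  unfold slit
  rw [mem_ofPred_eq, not_iff_not]
  constructor
  · intro h
    have h2 : inner ℝ e v = ‖e‖ * ‖v‖ := by rw [he, one_mul, h]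
    rw [inner_eq_norm_mul_iff_real, he, one_smul] at h2
    exact ⟨‖v‖, norm_nonneg _, h2.symm⟩
  · rintro ⟨s, hs, rfl⟩
    rw [inner_smul_right, real_inner_self_eq_norm_sq, norm_smul, he, Real.norm_of_nonneg hs]
    norm_num

lemma neg_mem_slit {e : E3} (he : ‖e‖ = 1) : -e ∈ slit e := by
  simp [slit, he]
  norm_num

lemma starConvex_slit {e : E3} (he : ‖e‖ = 1) : StarConvex ℝ (-e) (slit e) := by
  intro v hv a b ha hb hab
  rw [mem_slit_iff he] at hv ⊢
  rintro ⟨s, hs, h⟩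
  have h1 : b • v = (s + a) • e := by
    rw [add_smul, ← h]; simp
  rcases hb.eq_or_lt with rfl | hb'
  · have : (s + a) • e = 0 := by rw [← h1]; simp
    rw [smul_eq_zero] at this
    rcases this with h | h
    · linarith
    · rw [h] at he; simp at he
  · apply hv
    refine ⟨b⁻¹ * (s + a), by positivity, ?_⟩
    rw [mul_smul, ← h1, smul_smul, inv_mul_cancel₀ hb'.ne', one_smul]

lemma slit_union (e : E3) : slit e ∪ slit (-e) = {0}ᶜ ∨ ‖e‖ ≠ 1 := by
  by_cases he : ‖e‖ = 1
  · left
    ext v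
    simp only [slit, mem_union, mem_ofPred_eq, inner_neg_left, mem_compl_iff, mem_singleton_iff]
    constructor
    · rintro h rfl
      simp at h
    · intro h
      by_contra! h2
      have : ‖v‖ = 0 := by linarith
      exact h (norm_eq_zero.1 this)
  · exact Or.inr he

lemma slit_inter {e : E3} (he : ‖e‖ = 1) : IsPreconnected (slit e ∩ slit (-e)) := by
  have h1 : slit e ∩ slit (-e) = ((Submodule.span ℝ {e} : Submodule ℝ E3) : Set E3)ᶜ := by
    ext v
    rw [mem_inter_iff, mem_slit_iff he, mem_slit_iff (by rwa [norm_neg]), ← not_or, mem_compl_iff,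
      not_iff_not, SetLike.mem_coe, Submodule.mem_span_singleton]
    constructor
    · rintro (⟨s, _, rfl⟩ | ⟨s, _, rfl⟩)
      · exact ⟨s, rfl⟩
      · exact ⟨-s, by simp⟩
    · rintro ⟨s, rfl⟩
      rcases le_total 0 s with h | h
      · exact Or.inl ⟨s, h, rfl⟩
      · exact Or.inr ⟨-s, by linarith, by simp⟩
  rw [h1]
  refine (isConnected_compl_of_one_lt_codim ?_).isPreconnected
  have h2 := Submodule.finrank_quotient_add_finrank (Submodule.span ℝ {e} : Submodule ℝ E3)
  rw [finrank_span_singleton (by rintro rfl; simp at he)] at h2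
  simp only [finrank_euclideanSpace, Fintype.card_fin] at h2
  rw [← Module.finrank_eq_rank]
  have : 1 < Module.finrank ℝ (E3 ⧸ (Submodule.span ℝ {e} : Submodule ℝ E3)) := by omega
  exact_mod_cast this

lemma inner_pm {x y : Sph} (h : q x = q y) :
    (inner ℝ (x : E3) (y : E3) = 1 ∧ y = x) ∨ (inner ℝ (x : E3) (y : E3) = -1 ∧ y = anti x) := by
  rcases q_eq_iff.1 h with rfl | rfl
  · left; simp [norm_sph]
  · right; simp [norm_sph, anti]

lemma lift_punctured {f : E3 → RP2} (hf : ContinuousOn f {0}ᶜ) :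
    ∃ F : E3 → Sph, ContinuousOn F {0}ᶜ ∧ ∀ v ∈ ({0}ᶜ : Set E3), q (F v) = f v := by
  classical
  let e : E3 := EuclideanSpace.single 0 1
  have he : ‖e‖ = 1 := by simp [e]
  have he' : ‖-e‖ = 1 := by rwa [norm_neg]
  have hU := (slit_union e).resolve_right (by simp [he])
  obtain ⟨F, hF, hFq⟩ := lift_star (isOpen_slit e) (starConvex_slit he) (neg_mem_slit he)
    (hf.mono (by rw [← hU]; exact subset_union_left))
  obtain ⟨G, hG, hGq⟩ := lift_star (isOpen_slit (-e)) (starConvex_slit he') (neg_mem_slit he')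
    (hf.mono (by rw [← hU]; exact subset_union_right))
  have key : ∃ G' : E3 → Sph, ContinuousOn G' (slit (-e)) ∧ (∀ v ∈ slit (-e), q (G' v) = f v) ∧
      ∀ v ∈ slit e ∩ slit (-e), G' v = F v := by
    have hq : ∀ v ∈ slit e ∩ slit (-e), q (F v) = q (G v) := fun v hv => by
      rw [hFq v hv.1, hGq v hv.2]
    have hcont : ContinuousOn (fun v => inner ℝ (F v : E3) (G v : E3)) (slit e ∩ slit (-e)) := by
      have h1 := hF.mono (inter_subset_left (t := slit (-e)))
      have h2 := hG.mono (inter_subset_right (s := slit e))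
      fun_prop
    rcases pm_const (slit_inter he) hcont
      (fun v hv => (inner_pm (hq v hv)).imp And.left And.left) with h | h
    · refine ⟨G, hG, hGq, fun v hv => ?_⟩
      rcases inner_pm (hq v hv) with h2 | h2
      · exact h2.2
      · have := h v hv; rw [h2.1] at this; norm_num at this
    · refine ⟨fun v => anti (G v), continuous_anti.comp_continuousOn hG,
        fun v hv => by rw [q_anti, hGq v hv], fun v hv => ?_⟩
      rcases inner_pm (hq v hv) with h2 | h2
      · have := h v hv; rw [h2.1] at this; norm_num at this
      · change anti (G v) = F v
        rw [h2.2, anti_anti]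
  obtain ⟨G', hG', hG'q, hGF⟩ := key
  refine ⟨fun v => if v ∈ slit e then F v else G' v, ?_, ?_⟩
  · rw [← hU]
    apply ContinuousOn.union_of_isOpen _ _ (isOpen_slit e) (isOpen_slit (-e))
    · exact hF.congr (fun v hv => by simp [hv])
    · refine hG'.congr (fun v hv => ?_)
      by_cases h : v ∈ slit e
      · simp only [h, if_true]; exact (hGF v ⟨h, hv⟩).symm
      · simp [h]
  · intro v hv
    rw [← hU] at hv
    by_cases h : v ∈ slit e
    · simp only [h, if_true]; exact hFq v h
    · simp only [h, if_false]; exact hG'q v (hv.resolve_left h)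

/-! ### Structure of the suspension -/

lemma suspRel_exact {Y : Type*} {a b : Y × I1} (h : Quot.mk (suspRel Y) a = Quot.mk (suspRel Y) b) :
    a = b ∨ suspRel Y a b := by
  have h2 := Quot.eqvGen_exact h
  clear h
  induction h2 with
  | rel a b h => exact Or.inr h
  | refl a => exact Or.inl rfl
  | symm a b _ ih =>
    rcases ih with rfl | h
    · exact Or.inl rfl
    · right; exact h.imp And.symm And.symm
  | trans a b c _ _ ih1 ih2 =>
    rcases ih1 with rfl | h
    · exact ih2
    · rcases ih2 with rfl | hb
      · exact Or.inr h
      · right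
        rcases h with h | h <;> rcases hb with hb | hb
        · exact Or.inl ⟨h.1, hb.2⟩
        · have := h.2.symm.trans hb.1; norm_num at this
        · have := h.2.symm.trans hb.1; norm_num at this
        · exact Or.inr ⟨h.1, hb.2⟩

/-- The height coordinate. -/
def ht : Susp RP2 → ℝ := Quot.lift (fun a => (a.2 : ℝ)) (by
  rintro a b (h | h)
  · exact h.1.trans h.2.symm
  · exact h.1.trans h.2.symm)

lemma ht_Q (a : Sph × I1) : ht (Q a) = a.2 := rfl

lemma continuous_ht : Continuous ht := by
  refine isQuotientMap_Q.continuous_iff.2 ?_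
  exact continuous_subtype_val.comp continuous_snd

/-- A chosen representative. -/
noncomputable def rep (z : Susp RP2) : Sph × I1 := Function.surjInv isQuotientMap_Q.surjective z

lemma Q_rep (z : Susp RP2) : Q (rep z) = z := Function.surjInv_eq _ z

lemma rep_Q_snd (a : Sph × I1) : (rep (Q a)).2 = a.2 := by
  apply Subtype.ext
  rw [← ht_Q, Q_rep, ht_Q]

lemma q_rep_Q (a : Sph × I1) (h1 : (a.2 : ℝ) ≠ -1) (h2 : (a.2 : ℝ) ≠ 1) :
    q (rep (Q a)).1 = q a.1 := by
  rcases suspRel_exact (Q_rep (Q a)) with h | h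
  · exact congrArg Prod.fst h
  · rcases h with h | h
    · exact absurd h.2 h1
    · exact absurd h.2 h2

lemma rep_cases (a : Sph × I1) (h1 : (a.2 : ℝ) ≠ -1) (h2 : (a.2 : ℝ) ≠ 1) :
    (rep (Q a)).1 = a.1 ∨ (rep (Q a)).1 = anti a.1 :=
  q_eq_iff.1 (q_rep_Q a h1 h2).symm

lemma pole_eq {z w : Susp RP2} (h : ht z = ht w) (h1 : ht w = 1 ∨ ht w = -1) : z = w := by
  obtain ⟨a, rfl⟩ := isQuotientMap_Q.surjective z
  obtain ⟨b, rfl⟩ := isQuotientMap_Q.surjective w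
  rw [ht_Q, ht_Q] at *
  apply Quot.sound
  rcases h1 with h1 | h1
  · exact Or.inr ⟨h.trans h1, h1⟩
  · exact Or.inl ⟨h.trans h1, h1⟩

/-! ### The suspension points are not manifold points -/

lemma exists_near (c : I1) (hc : (c : ℝ) = 1 ∨ (c : ℝ) = -1) {V : Set I1} (hV : IsOpen V)
    (hcV : c ∈ V) : ∃ t ∈ V, (t : ℝ) ≠ 1 ∧ (t : ℝ) ≠ -1 := by
  obtain ⟨ε, hε, hb⟩ := Metric.isOpen_iff.1 hV c hcV
  set d := min ε 1 / 2 with hd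
  have hd0 : 0 < d := by positivity
  have hd1 : d ≤ 1 / 2 := by
    have := min_le_right ε 1; linarith
  have hd2 : d < ε := by
    have := min_le_left ε 1; linarith
  rcases hc with hc | hc
  · refine ⟨⟨1 - d, by constructor <;> linarith⟩, hb ?_, ?_, ?_⟩
    · rw [Metric.mem_ball, Subtype.dist_eq, hc, Real.dist_eq, abs_lt]
      constructor <;> simp <;> linarith
    · simp; linarith
    · simp; linarith
  · refine ⟨⟨-1 + d, by constructor <;> linarith⟩, hb ?_, ?_, ?_⟩
    · rw [Metric.mem_ball, Subtype.dist_eq, hc, Real.dist_eq, abs_lt]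
      constructor <;> simp <;> linarith
    · simp; linarith
    · simp; linarith

lemma one_lt_rank : 1 < Module.rank ℝ E3 := by
  rw [← Module.finrank_eq_rank]
  simp

instance : PreconnectedSpace Sph :=
  Subtype.preconnectedSpace (isPreconnected_sphere one_lt_rank 0 1)

instance : CompactSpace Sph := isCompact_iff_compactSpace.1 (isCompact_sphere 0 1)

lemma isOpen_mid : IsOpen {z : Susp RP2 | ht z ≠ 1 ∧ ht z ≠ -1} :=
  (isOpen_ne_fun continuous_ht continuous_const).inter
    (isOpen_ne_fun continuous_ht continuous_const)

lemma continuousOn_pr : ContinuousOn (fun z => q (rep z).1) {z : Susp RP2 | ht z ≠ 1 ∧ ht z ≠ -1} := by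
  rw [isQuotientMap_Q.continuousOn_isOpen_iff isOpen_mid]
  refine ContinuousOn.congr (f := fun a => q a.1) ?_ ?_
  · exact (isQuotientMap_q.continuous.comp continuous_fst).continuousOn
  · intro a ha
    exact q_rep_Q a ha.2 ha.1

lemma no_section (G : Sph → Sph) (hG : Continuous G) (hq : ∀ y, q (G y) = q y)
    (ha : ∀ y, G (anti y) = G y) (y₀ : Sph) : False := by
  have hc : ContinuousOn (fun y : Sph => inner ℝ (G y : E3) (y : E3)) univ := by
    apply Continuous.continuousOn; fun_prop
  have hneg : ∀ y : Sph, inner ℝ (G (anti y) : E3) (anti y : E3) = - inner ℝ (G y : E3) (y : E3) := by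
    intro y; rw [ha]; simp [anti]
  have h0 := hneg y₀
  rcases pm_const isPreconnected_univ hc
    (fun y _ => (inner_pm (hq y)).imp And.left And.left) with h | h
  · have h1 := h y₀ trivial
    have h2 := h (anti y₀) trivial
    rw [h1, h2] at h0; norm_num at h0
  · have h1 := h y₀ trivial
    have h2 := h (anti y₀) trivial
    rw [h1, h2] at h0; norm_num at h0

lemma no_embedding (c : I1) (hc : (c : ℝ) = 1 ∨ (c : ℝ) = -1) (ψ : E3 → Susp RP2)
    (hψ : IsOpenEmbedding ψ) (h0 : ht (ψ 0) = c) (hr : ∀ v, ht (ψ v) ≠ -c) (y₀ : Sph) : False := by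
  have hmid : ∀ v ∈ ({0}ᶜ : Set E3), ht (ψ v) ≠ 1 ∧ ht (ψ v) ≠ -1 := by
    intro v hv
    have h1 : ht (ψ v) ≠ c := by
      intro h
      exact hv (hψ.injective (pole_eq (h.trans h0.symm) (by rw [h0]; exact hc)))
    have h2 := hr v
    rcases hc with hc | hc <;> rw [hc] at h1 h2
    · exact ⟨h1, h2⟩
    · rw [neg_neg] at h2; exact ⟨h2, h1⟩
  obtain ⟨F, hF, hFq⟩ := lift_punctured (f := fun v => q (rep (ψ v)).1)
    (continuousOn_pr.comp hψ.continuous.continuousOn hmid)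
  obtain ⟨u, V, -, hV, hu, hcV, huV⟩ := generalized_tube_lemma (isCompact_univ (X := Sph))
    (isCompact_singleton (x := c)) (hψ.isOpen_range.preimage isQuotientMap_Q.continuous)
    (by
      rintro ⟨y, t⟩ ⟨-, ht'⟩
      have : t = c := ht'
      subst this
      exact ⟨0, pole_eq h0 hc⟩)
  obtain ⟨t, htV, ht1, ht2⟩ := exists_near c hc hV (hcV rfl)
  have hex : ∀ y : Sph, ∃ v, ψ v = Q (y, t) := fun y => huV ⟨hu trivial, htV⟩
  choose g hg using hex
  have hgc : Continuous g := by
    rw [hψ.isInducing.continuous_iff]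
    have : ψ ∘ g = fun y => Q (y, t) := funext hg
    rw [this]
    exact isQuotientMap_Q.continuous.comp (by fun_prop)
  have hg0 : ∀ y, g y ∈ ({0}ᶜ : Set E3) := by
    intro y h
    have h' : g y = 0 := h
    have h2 : ht (Q (y, t)) = c := by rw [← hg, h', h0]
    rw [ht_Q] at h2
    rcases hc with hc | hc <;> rw [hc] at h2
    · exact ht1 h2
    · exact ht2 h2
  refine no_section (fun y => F (g y)) (hF.comp_continuous hgc hg0) ?_ ?_ y₀
  · intro y
    rw [hFq _ (hg0 y), hg]
    exact q_rep_Q _ ht2 ht1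
  · intro y
    have : g (anti y) = g y := by
      apply hψ.injective
      rw [hg, hg]
      unfold Q
      simp only [q_anti]
      rfl
    simp only [this]

lemma pole_not_manifold (c : I1) (hc : (c : ℝ) = 1 ∨ (c : ℝ) = -1) (z : Susp RP2)
    (hz : ht z = c) : ¬ IsManifoldPoint z := by
  rintro ⟨U, hU, hzU, ⟨φ⟩⟩
  have hc' : (c : ℝ) ≠ -c := by rcases hc with h | h <;> rw [h] <;> norm_num
  have hemb : IsOpenEmbedding (fun v => ((φ.symm v : U) : Susp RP2)) :=
    hU.isOpenEmbedding_subtypeVal.comp φ.symm.isOpenEmbedding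
  have hO : IsOpen {v : E3 | ht (φ.symm v : U) ≠ -c} :=
    isOpen_ne_fun (continuous_ht.comp hemb.continuous) continuous_const
  set c₀ := φ ⟨z, hzU⟩ with hc₀
  have hφ : ((φ.symm c₀ : U) : Susp RP2) = z := by rw [hc₀, φ.symm_apply_apply]
  obtain ⟨r, hr, hb⟩ := Metric.isOpen_iff.1 hO c₀ (by
    change ht (φ.symm c₀ : U) ≠ -c
    rw [hφ, hz]; exact hc')
  let B := OpenPartialHomeomorph.univBall (E := E3) c₀ r
  have hB : IsOpenEmbedding B := B.isOpenEmbedding (OpenPartialHomeomorph.univBall_source _ _)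
  refine no_embedding c hc (fun v => ((φ.symm (B v) : U) : Susp RP2)) (hemb.comp hB) ?_ ?_ (rep z).1
  · simp only [B, OpenPartialHomeomorph.univBall_apply_zero]
    rw [hφ, hz]
  · intro v
    apply hb
    rw [← OpenPartialHomeomorph.univBall_target c₀ hr]
    exact B.map_source (by rw [OpenPartialHomeomorph.univBall_source]; trivial)

/-! ### The remaining points are manifold points -/

/-- `ℝ → (-1,1)` -/
noncomputable def g1 (s : ℝ) : ℝ := s / (1 + |s|)

/-- `(-1,1) → ℝ` -/
noncomputable def g2 (t : ℝ) : ℝ := t / (1 - |t|)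

lemma continuous_g1 : Continuous g1 := by
  unfold g1
  refine Continuous.div (by fun_prop) (by fun_prop) (fun s => ?_)
  positivity

lemma abs_g1 (s : ℝ) : |g1 s| = |s| / (1 + |s|) := by
  unfold g1
  have : 0 < 1 + |s| := by positivity
  rw [abs_div, abs_of_pos this]

lemma abs_g1_lt (s : ℝ) : |g1 s| < 1 := by
  rw [abs_g1, div_lt_one (by positivity)]
  linarith

lemma g2_g1 (s : ℝ) : g2 (g1 s) = s := by
  unfold g2
  rw [abs_g1]
  unfold g1
  have : (1 + |s|) ≠ 0 := by positivity
  field_simp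
  ring

lemma g1_g2 {t : ℝ} (h : |t| < 1) : g1 (g2 t) = t := by
  have h0 : 0 < 1 - |t| := by linarith
  unfold g1 g2
  rw [abs_div, abs_of_pos h0]
  field_simp
  ring

/-- The direction through `x + (v - ⟨x,v⟩ x)`. -/
noncomputable def dir (x : Sph) (v : E3) : E3 := (x : E3) + (v - inner ℝ (x : E3) v • (x : E3))

lemma inner_dir (x : Sph) (v : E3) : inner ℝ (x : E3) (dir x v) = 1 := by
  simp [dir, inner_add_right, inner_sub_right, inner_smul_right, norm_sph]

lemma dir_ne (x : Sph) (v : E3) : dir x v ≠ 0 := by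
  intro h
  have := inner_dir x v
  rw [h] at this
  simp at this

lemma continuous_dir (x : Sph) : Continuous (dir x) := by
  unfold dir; fun_prop

/-- Normalised direction. -/
noncomputable def ndir (x : Sph) (v : E3) : Sph :=
  ⟨‖dir x v‖⁻¹ • dir x v, by
    rw [mem_sph, norm_smul, norm_inv, norm_norm,
      inv_mul_cancel₀ (norm_ne_zero_iff.2 (dir_ne x v))]⟩

lemma continuous_ndir (x : Sph) : Continuous (ndir x) := by
  unfold ndir
  refine Continuous.subtype_mk ?_ _
  exact ((continuous_dir x).norm.inv₀ (fun v => norm_ne_zero_iff.2 (dir_ne x v))).smul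
    (continuous_dir x)

/-- The chart upstairs. -/
noncomputable def chart (x : Sph) (a : Sph × I1) : E3 :=
  (inner ℝ (x : E3) (a.1 : E3))⁻¹ • (a.1 : E3) - (x : E3) + g2 a.2 • (x : E3)

lemma chart_anti (x y : Sph) (t : I1) : chart x (anti y, t) = chart x (y, t) := by
  simp [chart, anti, inv_neg]

/-- The inverse chart. -/
noncomputable def par (x : Sph) (v : E3) : Sph × I1 :=
  (ndir x v, ⟨g1 (inner ℝ (x : E3) v), abs_le.1 (abs_g1_lt _).le⟩)

lemma continuous_par (x : Sph) : Continuous (par x) := by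
  unfold par
  refine (continuous_ndir x).prodMk (Continuous.subtype_mk ?_ _)
  exact continuous_g1.comp (by fun_prop)

lemma chart_par (x : Sph) (v : E3) : chart x (par x v) = v := by
  have h : ‖dir x v‖ ≠ 0 := norm_ne_zero_iff.2 (dir_ne x v)
  simp only [chart, par, ndir, g2_g1, inner_smul_right, inner_dir, mul_one, inv_inv, smul_smul,
    mul_inv_cancel₀ h, one_smul]
  unfold dir
  abel

/-- Domain of the chart. -/
def dom (x : Sph) : Set (Sph × I1) := {a | |(a.2 : ℝ)| < 1 ∧ inner ℝ (x : E3) (a.1 : E3) ≠ 0}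

lemma isOpen_dom (x : Sph) : IsOpen (dom x) := by
  have h1 : IsOpen {a : Sph × I1 | |(a.2 : ℝ)| < 1} :=
    isOpen_lt (by fun_prop) continuous_const
  have h2 : IsOpen {a : Sph × I1 | inner ℝ (x : E3) (a.1 : E3) ≠ 0} :=
    isOpen_ne_fun (by fun_prop) continuous_const
  exact h1.inter h2

lemma par_mem (x : Sph) (v : E3) : par x v ∈ dom x := by
  refine ⟨abs_g1_lt _, ?_⟩
  have h : ‖dir x v‖ ≠ 0 := norm_ne_zero_iff.2 (dir_ne x v)
  simp only [par, ndir, inner_smul_right, inner_dir, mul_one]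
  exact inv_ne_zero h

lemma Q_anti (y : Sph) (t : I1) : Q (anti y, t) = Q (y, t) := by
  unfold Q
  simp only [q_anti]
  rfl

lemma Q_par_chart (x : Sph) {a : Sph × I1} (ha : a ∈ dom x) : Q (par x (chart x a)) = Q a := by
  obtain ⟨y, t⟩ := a
  obtain ⟨h1, h2⟩ := ha
  simp only at h1 h2
  set s := inner ℝ (x : E3) (y : E3) with hs
  have hin : inner ℝ (x : E3) (chart x (y, t)) = g2 t := by
    simp [chart, inner_add_right, inner_sub_right, inner_smul_right, norm_sph, ← hs, h2]
  have hd : dir x (chart x (y, t)) = s⁻¹ • (y : E3) := by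
    unfold dir
    rw [hin]
    simp only [chart, ← hs]
    abel
  have ht : (par x (chart x (y, t))).2 = t := by
    apply Subtype.ext
    simp only [par, hin, g1_g2 h1]
  have hn : ((par x (chart x (y, t))).1 : E3) = (|s| * s⁻¹) • (y : E3) := by
    simp only [par, ndir, hd, norm_smul, norm_sph, norm_inv, Real.norm_eq_abs, mul_one, inv_inv,
      smul_smul]
  have hp : par x (chart x (y, t)) = ((par x (chart x (y, t))).1, t) := Prod.ext rfl ht
  rw [hp]
  rcases lt_or_gt_of_ne h2 with h | h
  · have : (par x (chart x (y, t))).1 = anti y := by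
      apply Subtype.ext
      rw [hn, abs_of_neg h]
      simp [anti, h2]
    rw [this, Q_anti]
  · have : (par x (chart x (y, t))).1 = y := by
      apply Subtype.ext
      rw [hn, abs_of_pos h]
      simp [h2]
    rw [this]

lemma abs_lt_ne {t : ℝ} (h : |t| < 1) : t ≠ -1 ∧ t ≠ 1 := by
  constructor <;> rintro rfl <;> norm_num at h

lemma chart_rep (x : Sph) {a : Sph × I1} (ha : |(a.2 : ℝ)| < 1) :
    chart x (rep (Q a)) = chart x a := by
  obtain ⟨h1, h2⟩ := abs_lt_ne ha
  have h : rep (Q a) = ((rep (Q a)).1, a.2) := Prod.ext rfl (rep_Q_snd a)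
  rcases rep_cases a h1 h2 with h' | h' <;> rw [h, h']
  rw [chart_anti]

lemma rep_mem_dom (x : Sph) (a : Sph × I1) : rep (Q a) ∈ dom x ↔ a ∈ dom x := by
  unfold dom
  simp only [mem_ofPred_eq, rep_Q_snd]
  refine and_congr_right (fun ha => ?_)
  obtain ⟨h1, h2⟩ := abs_lt_ne ha
  rcases rep_cases a h1 h2 with h' | h' <;> rw [h']
  simp [anti]

lemma mid_manifold (x : Sph) (t : I1) (h : |(t : ℝ)| < 1) : IsManifoldPoint (Q (x, t)) := by
  let U : Set (Susp RP2) := {z | rep z ∈ dom x}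
  have hpre : Q ⁻¹' U = dom x := by
    ext a; exact rep_mem_dom x a
  have hU : IsOpen U := by
    rw [← isQuotientMap_Q.isOpen_preimage, hpre]; exact isOpen_dom x
  have hc : ContinuousOn (fun z => chart x (rep z)) U := by
    rw [isQuotientMap_Q.continuousOn_isOpen_iff hU, hpre]
    refine ContinuousOn.congr (f := chart x) ?_ (fun a ha => chart_rep x ha.1)
    have c1 : ContinuousOn (fun a : Sph × I1 => (inner ℝ (x : E3) (a.1 : E3))⁻¹) (dom x) :=
      ContinuousOn.inv₀ (by fun_prop) (fun a ha => ha.2)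
    have c2 : ContinuousOn (fun a : Sph × I1 => g2 a.2) (dom x) := by
      unfold g2
      refine ContinuousOn.div (by fun_prop) (by fun_prop) (fun a ha => ?_)
      have := ha.1
      linarith
    unfold chart
    fun_prop
  refine ⟨U, hU, ?_, ⟨?_⟩⟩
  · change (x, t) ∈ Q ⁻¹' U
    rw [hpre]
    exact ⟨h, by simp [norm_sph]⟩
  · exact
    { toFun := fun z => chart x (rep (z : Susp RP2))
      invFun := fun v => ⟨Q (par x v), (rep_mem_dom x _).2 (par_mem x v)⟩
      left_inv := fun z => by
        apply Subtype.ext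
        change Q (par x (chart x (rep (z : Susp RP2)))) = z
        rw [Q_par_chart x z.2, Q_rep]
      right_inv := fun v => by
        change chart x (rep (Q (par x v))) = v
        rw [chart_rep x (par_mem x v).1, chart_par]
      continuous_toFun := hc.domRestrict
      continuous_invFun :=
        Continuous.subtype_mk (isQuotientMap_Q.continuous.comp (continuous_par x)) _ }

end SuspAux

/-- The suspension `S(ℝP²)` is homeomorphic to `S³/τ`, where `τ` is the suspension of
the antipodal map of `S²` acting on `S(S²) ≅ S³`; moreover `S(ℝP²)` has exactly two
non-manifold points, namely the two suspension points. -/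
theorem stmt18 :
    Nonempty (Susp RP2 ≃ₜ Quot tauRel) ∧
    ∃ pN pS : Susp RP2, pN ≠ pS ∧
      (∃ (x₀ : RP2) (t₁ tₘ : Icc (-1:ℝ) 1), (t₁ : ℝ) = 1 ∧ (tₘ : ℝ) = -1 ∧
        pN = Quot.mk _ (x₀, t₁) ∧ pS = Quot.mk _ (x₀, tₘ)) ∧
      (∀ z : Susp RP2, ¬ IsManifoldPoint z ↔ (z = pN ∨ z = pS)) := by
  refine ⟨SuspAux.part1, ?_⟩
  have h1 : (1 : ℝ) ∈ Icc (-1 : ℝ) 1 := by constructor <;> norm_num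
  have h2 : (-1 : ℝ) ∈ Icc (-1 : ℝ) 1 := by constructor <;> norm_num
  let y : Sph := ⟨EuclideanSpace.single 0 1, by simp [Sph]⟩
  refine ⟨SuspAux.Q (y, ⟨1, h1⟩), SuspAux.Q (y, ⟨-1, h2⟩), ?_,
    ⟨SuspAux.q y, ⟨1, h1⟩, ⟨-1, h2⟩, rfl, rfl, rfl, rfl⟩, ?_⟩
  · intro h
    have := congrArg SuspAux.ht h
    rw [SuspAux.ht_Q, SuspAux.ht_Q] at this
    norm_num at this
  · intro z
    constructor
    · intro hz
      by_contra! hne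
      obtain ⟨⟨x, t⟩, rfl⟩ := SuspAux.isQuotientMap_Q.surjective z
      apply hz
      apply SuspAux.mid_manifold
      rw [abs_lt]
      constructor
      · refine lt_of_le_of_ne t.2.1 (fun h => hne.2 ?_)
        exact SuspAux.pole_eq h.symm (Or.inr rfl)
      · refine lt_of_le_of_ne t.2.2 (fun h => hne.1 ?_)
        exact SuspAux.pole_eq h (Or.inl rfl)
    · rintro (rfl | rfl)
      · exact SuspAux.pole_not_manifold ⟨1, h1⟩ (Or.inl rfl) _ rfl
      · exact SuspAux.pole_not_manifold ⟨-1, h2⟩ (Or.inr rfl) _ rfl
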